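/- Assume hypotheses (V) and (K). Suppose there exists R₁ > 0 such that V(r) < +∞ for almost every r ∈ (0,R₁), ess sup_{r∈(0,R₁)} K(r)/(r^{α₀} V(r)^{β₀}) < +∞ for some 0 ≤ β₀ ≤ 1 and α₀ ∈ ℝ, and ess inf_{r∈(0,R₁)} r^{γ₀} V(r) > 0 for some γ₀ ≥ 4. Then lim_{R→0⁺} R₀(q₁,R) = 0 for every q₁ ∈ ℝ such that (α₀,q₁) ∈ A_{β₀,γ₀}. -/

import Mathlib

open MeasureTheory Filter Topology Set ENNReal

noncomputable section

/-- Euclidean space `ℝ^N`. -/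
abbrev E (N : ℕ) := EuclideanSpace ℝ (Fin N)

/-- The (classical) Laplacian of a function `φ : ℝ^N → ℝ`. -/
def lapl {N : ℕ} (φ : E N → ℝ) (x : E N) : ℝ :=
  ∑ i : Fin N, fderiv ℝ (fun y => fderiv ℝ φ y (EuclideanSpace.single i 1)) x
    (EuclideanSpace.single i 1)

/-- A function is radial if it depends only on the norm. -/
def IsRadial {N : ℕ} (u : E N → ℝ) : Prop := ∀ x y : E N, ‖x‖ = ‖y‖ → u x = u y

/-- The critical exponent `2** = 2N/(N-4)` as an element of `ℝ≥0∞`. -/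
def twoSS (N : ℕ) : ℝ≥0∞ := (2 * N : ℝ≥0∞) / ((N : ℝ≥0∞) - 4)

/-- `u ∈ D^{2,2}(ℝ^N)` with (distributional) Laplacian `w`: `u` lies in `L^{2**}`,
`w ∈ L²`, and `u` is the limit in `L^{2**}` of smooth compactly supported functions whose
Laplacians converge to `w` in `L²` (i.e. `u` lies in the closure of `C_c^∞` for the norm
`‖Δ·‖_{L²}`, with `Δu = w`). -/
def MemD22 (N : ℕ) (u w : E N → ℝ) : Prop :=
  MemLp u (twoSS N) volume ∧ MemLp w 2 volume ∧
  ∃ φ : ℕ → E N → ℝ,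
    (∀ n, ContDiff ℝ (⊤ : ℕ∞) (φ n) ∧ HasCompactSupport (φ n)) ∧
    Tendsto (fun n => eLpNorm (fun x => φ n x - u x) (twoSS N) volume) atTop (𝓝 0) ∧
    Tendsto (fun n => eLpNorm (fun x => lapl (φ n) x - w x) 2 volume) atTop (𝓝 0)

/-- `u ∈ H²_V(ℝ^N)` (with Laplacian `w`). -/
def MemH2V {N : ℕ} (V : ℝ → ℝ≥0∞) (u w : E N → ℝ) : Prop :=
  MemD22 N u w ∧ (∫⁻ x : E N, V ‖x‖ * ENNReal.ofReal ((u x) ^ 2)) < ⊤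

/-- `u ∈ H²_{V,r}(ℝ^N)`: member of `H²_V` which is radial. -/
def MemH2Vr {N : ℕ} (V : ℝ → ℝ≥0∞) (u w : E N → ℝ) : Prop :=
  MemH2V V u w ∧ IsRadial u

/-- The norm of `H²_V`: `‖u‖ = (∫ |Δu|² + V(|x|)u²)^{1/2}` (here `w = Δu`). -/
def H2norm {N : ℕ} (V : ℝ → ℝ≥0∞) (u w : E N → ℝ) : ℝ :=
  (((∫⁻ x : E N, ENNReal.ofReal ((w x) ^ 2)) +
    ∫⁻ x : E N, V ‖x‖ * ENNReal.ofReal ((u x) ^ 2)).toReal) ^ (1/2 : ℝ)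

/-- Hypothesis (V): `V : (0,∞) → [0,∞]` measurable and locally integrable on `(0,∞)`. -/
def HypV (V : ℝ → ℝ≥0∞) : Prop :=
  Measurable V ∧ ∀ a b : ℝ, 0 < a → (∫⁻ r in Set.Icc a b, V r) < ⊤

/-- Hypothesis (K): `K : (0,∞) → (0,∞)` measurable with `K ∈ L^s_loc((0,∞))`. -/
def HypK (K : ℝ → ℝ) (s : ℝ) : Prop :=
  (∀ r : ℝ, 0 < r → 0 < K r) ∧ Measurable K ∧ 1 < s ∧
  ∀ a b : ℝ, 0 < a → IntegrableOn (fun r => K r ^ s) (Set.Icc a b) volume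

/-- The quantity `S₀(q,R)`. -/
def S0 (N : ℕ) (V : ℝ → ℝ≥0∞) (K : ℝ → ℝ) (q R : ℝ) : ℝ≥0∞ :=
  ⨆ p : {p : (E N → ℝ) × (E N → ℝ) // MemH2Vr V p.1 p.2 ∧ H2norm V p.1 p.2 = 1},
    ∫⁻ x in Metric.ball (0 : E N) R, ENNReal.ofReal (K ‖x‖ * |p.1.1 x| ^ q)

/-- The quantity `S_∞(q,R)`. -/
def Sinf (N : ℕ) (V : ℝ → ℝ≥0∞) (K : ℝ → ℝ) (q R : ℝ) : ℝ≥0∞ :=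
  ⨆ p : {p : (E N → ℝ) × (E N → ℝ) // MemH2Vr V p.1 p.2 ∧ H2norm V p.1 p.2 = 1},
    ∫⁻ x in (Metric.ball (0 : E N) R)ᶜ, ENNReal.ofReal (K ‖x‖ * |p.1.1 x| ^ q)

/-- The quantity `R₀(q,R)`. -/
def R0 (N : ℕ) (V : ℝ → ℝ≥0∞) (K : ℝ → ℝ) (q R : ℝ) : ℝ≥0∞ :=
  ⨆ p : {p : ((E N → ℝ) × (E N → ℝ)) × ((E N → ℝ) × (E N → ℝ)) //
      MemH2Vr V p.1.1 p.1.2 ∧ MemH2Vr V p.2.1 p.2.2 ∧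
      H2norm V p.1.1 p.1.2 = 1 ∧ H2norm V p.2.1 p.2.2 = 1},
    ∫⁻ x in Metric.ball (0 : E N) R,
      ENNReal.ofReal (K ‖x‖ * |p.1.1.1 x| ^ (q - 1) * |p.1.2.1 x|)

/-- The quantity `R_∞(q,R)`. -/
def Rinf (N : ℕ) (V : ℝ → ℝ≥0∞) (K : ℝ → ℝ) (q R : ℝ) : ℝ≥0∞ :=
  ⨆ p : {p : ((E N → ℝ) × (E N → ℝ)) × ((E N → ℝ) × (E N → ℝ)) //
      MemH2Vr V p.1.1 p.1.2 ∧ MemH2Vr V p.2.1 p.2.2 ∧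
      H2norm V p.1.1 p.1.2 = 1 ∧ H2norm V p.2.1 p.2.2 = 1},
    ∫⁻ x in (Metric.ball (0 : E N) R)ᶜ,
      ENNReal.ofReal (K ‖x‖ * |p.1.1.1 x| ^ (q - 1) * |p.1.2.1 x|)

/-- The weighted measure `K(|x|)dx`. -/
def Kmeas (N : ℕ) (K : ℝ → ℝ) : Measure (E N) :=
  volume.withDensity (fun x => ENNReal.ofReal (K ‖x‖))

/-- Membership in the sum space `L^{q₁}_K + L^{q₂}_K`. -/
def MemSum (N : ℕ) (K : ℝ → ℝ) (q1 q2 : ℝ) (u : E N → ℝ) : Prop :=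
  ∃ u1 u2 : E N → ℝ, u = u1 + u2 ∧ MemLp u1 (ENNReal.ofReal q1) (Kmeas N K) ∧
    MemLp u2 (ENNReal.ofReal q2) (Kmeas N K)

/-- The norm of the sum space `L^{q₁}_K + L^{q₂}_K`. -/
def sumNorm (N : ℕ) (K : ℝ → ℝ) (q1 q2 : ℝ) (u : E N → ℝ) : ℝ≥0∞ :=
  ⨅ p : {p : (E N → ℝ) × (E N → ℝ) // u = p.1 + p.2},
    max (eLpNorm p.1.1 (ENNReal.ofReal q1) (Kmeas N K))
        (eLpNorm p.1.2 (ENNReal.ofReal q2) (Kmeas N K))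

/-- `σ_N`, the (N-1)-dimensional measure of the unit sphere, i.e. `N·ω_N`. -/
def sigmaN (N : ℕ) : ℝ := N * (volume (Metric.ball (0 : E N) 1)).toReal

end

noncomputable section

/-- `q_*(α,β,γ) = 2(α-γβ+N)/(N-γ)`. -/
def qLow (N : ℕ) (α β γ : ℝ) : ℝ := 2 * (α - γ*β + N) / (N - γ)

/-- `q_{**}(α,β,γ) = 2(2α+(1-2β)γ+2(N-2))/(2(N-2)-γ)`. -/
def qHigh (N : ℕ) (α β γ : ℝ) : ℝ := 2 * (2*α + (1-2*β)*γ + 2*(N-2)) / (2*(N-2) - γ)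

open Classical in
/-- The set `𝒜_{β,γ}` of pairs `(α,q)` (for `γ ≥ 4`), defined by cases on `γ`. -/
def Aset (N : ℕ) (β γ : ℝ) : Set (ℝ × ℝ) :=
  if γ < N then
    {p | max 1 (2*β) < p.2 ∧ p.2 < min (qLow N p.1 β γ) (qHigh N p.1 β γ)}
  else if γ = N then
    {p | max 1 (2*β) < p.2 ∧ p.2 < qHigh N p.1 β γ ∧ -(1-β)*N < p.1}
  else if γ < 2*N - 4 then
    {p | max (max 1 (2*β)) (qLow N p.1 β γ) < p.2 ∧ p.2 < qHigh N p.1 β γ}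
  else if γ = 2*N - 4 then
    {p | max (max 1 (2*β)) (qLow N p.1 β γ) < p.2 ∧ -(1-β)*γ < p.1}
  else
    {p | max (max (max 1 (2*β)) (qLow N p.1 β γ)) (qHigh N p.1 β γ) < p.2}

lemma one_le_twoSS (N : ℕ) (hN : 5 ≤ N) : 1 ≤ twoSS N := by
  unfold twoSS
  have h0 : (N : ℝ≥0∞) - 4 ≠ 0 := by
    have : ((4:ℕ) : ℝ≥0∞) < N := by exact_mod_cast (by omega : 4 < N)
    rw [← pos_iff_ne_zero, tsub_pos_iff_lt]; exact_mod_cast this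
  rw [ENNReal.le_div_iff_mul_le (Or.inl h0) (Or.inr (by finiteness))]
  rw [one_mul]
  refine tsub_le_self.trans ?_
  rw [two_mul]; exact le_self_add

/-- Bounded test function with support in a ball: passage to the limit in the integral. -/
lemma tendsto_integral_mul_of_eLpNorm {N : ℕ} {p : ℝ≥0∞} (hp : 1 ≤ p) {u : E N → ℝ}
    {φ : ℕ → E N → ℝ} (hu : MemLp u p volume) (hφ : ∀ n, Continuous (φ n))
    (h : Tendsto (fun n => eLpNorm (fun x => φ n x - u x) p volume) atTop (𝓝 0))
    {g : E N → ℝ} (hg : Continuous g) (hgc : HasCompactSupport g) :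
    Tendsto (fun n => ∫ x, φ n x * g x) atTop (𝓝 (∫ x, u x * g x)) := by
  have hgint : ∀ n, Integrable (fun x => φ n x * g x) volume := fun n =>
    ((hφ n).mul hg).integrable_of_hasCompactSupport hgc.mul_left
  obtain ⟨M, hM⟩ := hg.bounded_above_of_compact_support hgc
  have hM0 : 0 ≤ M := (norm_nonneg _).trans (hM 0)
  set S := tsupport g
  have hS : IsCompact S := hgc
  have hSm : MeasurableSet S := hS.isClosed.measurableSet
  have hSfin : volume S < ⊤ := hS.measure_lt_top
  have key : ∀ v : E N → ℝ, AEStronglyMeasurable v volume →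
      ∫⁻ x, ‖v x * g x‖ₑ ≤ ENNReal.ofReal M *
        (eLpNorm v p volume * volume S ^ (1 - 1 / p.toReal)) := by
    intro v hv
    calc ∫⁻ x, ‖v x * g x‖ₑ ≤ ∫⁻ x, S.indicator (fun x => ENNReal.ofReal M * ‖v x‖ₑ) x := by
          apply lintegral_mono
          intro x
          by_cases hx : x ∈ S
          · simp only [indicator_of_mem hx, enorm_mul]
            rw [mul_comm]
            gcongr
            rw [← ofReal_norm]
            exact ENNReal.ofReal_le_ofReal (hM x)
          · simp [indicator_of_notMem hx, image_eq_zero_of_notMem_tsupport hx]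
      _ = ENNReal.ofReal M * eLpNorm v 1 (volume.restrict S) := by
          rw [lintegral_indicator hSm, lintegral_const_mul' _ _ (by finiteness),
            eLpNorm_one_eq_lintegral_enorm]
      _ ≤ ENNReal.ofReal M * (eLpNorm v p (volume.restrict S) *
            (volume.restrict S) univ ^ (1 / (1:ℝ≥0∞).toReal - 1 / p.toReal)) := by
          gcongr
          exact eLpNorm_le_eLpNorm_mul_rpow_measure_univ hp hv.restrict
      _ ≤ _ := by
          simp only [Measure.restrict_apply_univ, ENNReal.toReal_one, div_one]
          gcongr
          exact Measure.restrict_le_self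
  have hexp : 0 ≤ 1 - 1 / p.toReal := by
    rcases eq_or_ne p ⊤ with rfl | hpt
    · simp
    · have : 1 ≤ p.toReal := by
        have := ENNReal.toReal_mono hpt hp
        simpa using this
      rw [sub_nonneg, div_le_one (by linarith)]; exact this
  have hcfin : volume S ^ (1 - 1 / p.toReal) ≠ ⊤ := ENNReal.rpow_ne_top_of_nonneg hexp hSfin.ne
  refine tendsto_integral_of_L1 _ (hu.1.mul hg.aestronglyMeasurable) ?_ ?_
  · exact Eventually.of_forall hgint
  · have hub : ∀ n, ∫⁻ x, ‖φ n x * g x - u x * g x‖ₑ ≤ ENNReal.ofReal M *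
        (eLpNorm (fun x => φ n x - u x) p volume * volume S ^ (1 - 1 / p.toReal)) := by
      intro n
      have := key (fun x => φ n x - u x) ((hφ n).aestronglyMeasurable.sub hu.1)
      simpa [sub_mul] using this
    refine tendsto_of_tendsto_of_tendsto_of_le_of_le tendsto_const_nhds ?_ (fun _ => zero_le) hub
    have h1 := ENNReal.Tendsto.mul_const (b := volume S ^ (1 - 1 / p.toReal)) h (Or.inr hcfin)
    have h2 := ENNReal.Tendsto.const_mul (a := ENNReal.ofReal M) h1 (Or.inr (by finiteness))
    simpa using h2

lemma lapl_cont {N : ℕ} {φ : E N → ℝ} (h : ContDiff ℝ 2 φ) : Continuous (lapl φ) := by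
  unfold lapl
  apply continuous_finsetSum
  intro i _
  have h1 : ContDiff ℝ 1 (fun y => fderiv ℝ φ y (EuclideanSpace.single i 1)) :=
    (h.fderiv_right (m := 1) (by norm_num)).clm_apply contDiff_const
  exact (h1.continuous_fderiv (by norm_num)).clm_apply continuous_const

lemma lapl_symm {N : ℕ} {φ ψ : E N → ℝ} (hφ : ContDiff ℝ 2 φ) (hψ : ContDiff ℝ 2 ψ)
    (hψc : HasCompactSupport ψ) :
    ∫ x, φ x * lapl ψ x = ∫ x, lapl φ x * ψ x := by
  unfold lapl
  have d1 : ∀ f : E N → ℝ, ContDiff ℝ 2 f → ∀ i : Fin N,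
      ContDiff ℝ 1 (fun y => fderiv ℝ f y (EuclideanSpace.single i 1)) := fun f hf i =>
    (hf.fderiv_right (m := 1) (by norm_num)).clm_apply contDiff_const
  have c2 : ∀ f : E N → ℝ, ContDiff ℝ 2 f → ∀ i : Fin N, Continuous (fun x => 
      fderiv ℝ (fun y => fderiv ℝ f y (EuclideanSpace.single i 1)) x (EuclideanSpace.single i 1)) :=
    fun f hf i => ((d1 f hf i).continuous_fderiv (by norm_num)).clm_apply continuous_const
  have s1 : ∀ i : Fin N, HasCompactSupport (fun y => fderiv ℝ ψ y (EuclideanSpace.single i 1)) :=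
    fun i => hψc.fderiv_apply (𝕜 := ℝ) _
  have s2 : ∀ i : Fin N, HasCompactSupport (fun x => 
      fderiv ℝ (fun y => fderiv ℝ ψ y (EuclideanSpace.single i 1)) x (EuclideanSpace.single i 1)) :=
    fun i => (s1 i).fderiv_apply (𝕜 := ℝ) _
  simp only [Finset.mul_sum, Finset.sum_mul]
  rw [integral_finsetSum, integral_finsetSum]
  · apply Finset.sum_congr rfl
    intro i _
    have I1 := integral_mul_fderiv_eq_neg_fderiv_mul_of_integrable (μ := (volume : Measure (E N)))
      (f := φ) (g := fun y => fderiv ℝ ψ y (EuclideanSpace.single i 1))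
      (v := EuclideanSpace.single i 1)
      (((d1 φ hφ i).continuous.mul (d1 ψ hψ i).continuous).integrable_of_hasCompactSupport
        (s1 i).mul_left)
      ((hφ.continuous.mul (c2 ψ hψ i)).integrable_of_hasCompactSupport (s2 i).mul_left)
      ((hφ.continuous.mul (d1 ψ hψ i).continuous).integrable_of_hasCompactSupport (s1 i).mul_left)
      (fun x _ => (hφ.differentiable (by norm_num)) x)
      (fun x _ => ((d1 ψ hψ i).differentiable (by norm_num)) x)
    have I2 := integral_mul_fderiv_eq_neg_fderiv_mul_of_integrable (μ := (volume : Measure (E N)))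
      (f := fun y => fderiv ℝ φ y (EuclideanSpace.single i 1)) (g := ψ)
      (v := EuclideanSpace.single i 1)
      (((c2 φ hφ i).mul hψ.continuous).integrable_of_hasCompactSupport hψc.mul_left)
      (((d1 φ hφ i).continuous.mul (d1 ψ hψ i).continuous).integrable_of_hasCompactSupport
        (s1 i).mul_left)
      (((d1 φ hφ i).continuous.mul hψ.continuous).integrable_of_hasCompactSupport hψc.mul_left)
      (fun x _ => ((d1 φ hφ i).differentiable (by norm_num)) x)
      (fun x _ => (hψ.differentiable (by norm_num)) x)
    rw [I1, I2, neg_neg]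
  · intro i _
    exact ((c2 φ hφ i).mul hψ.continuous).integrable_of_hasCompactSupport hψc.mul_left
  · intro i _
    exact (hφ.continuous.mul (c2 ψ hψ i)).integrable_of_hasCompactSupport (s2 i).mul_left

lemma lapl_compact {N : ℕ} {ψ : E N → ℝ} (hψc : HasCompactSupport ψ) :
    HasCompactSupport (lapl ψ) := by
  refine HasCompactSupport.intro (K := tsupport ψ) hψc ?_
  intro x hx
  have h1 : ψ =ᶠ[𝓝 x] fun _ => 0 := notMem_tsupport_iff_eventuallyEq.mp hx
  unfold lapl
  apply Finset.sum_eq_zero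
  intro i _
  have h2 : (fun y => fderiv ℝ ψ y (EuclideanSpace.single i 1)) =ᶠ[𝓝 x] fun _ => 0 := by
    filter_upwards [h1.fderiv (𝕜 := ℝ)] with y hy
    rw [hy]; simp
  rw [h2.fderiv_eq]; simp

lemma weak_lapl {N : ℕ} (hN : 5 ≤ N) {u w ψ : E N → ℝ} (h : MemD22 N u w)
    (hψ : ContDiff ℝ 2 ψ) (hψc : HasCompactSupport ψ) :
    ∫ x, u x * lapl ψ x = ∫ x, w x * ψ x := by
  obtain ⟨hu, hw, φ, hφ, h1, h2⟩ := h
  have hφ2 : ∀ n, ContDiff ℝ 2 (φ n) := fun n => (hφ n).1.of_le (WithTop.coe_le_coe.mpr le_top)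
  have t1 := tendsto_integral_mul_of_eLpNorm (one_le_twoSS N hN) hu
    (fun n => (hφ2 n).continuous) h1 (lapl_cont hψ) (lapl_compact hψc)
  have t2 := tendsto_integral_mul_of_eLpNorm (by norm_num) hw
    (fun n => lapl_cont (hφ2 n)) h2 hψ.continuous hψc
  refine tendsto_nhds_unique t1 ?_
  simpa only [lapl_symm (hφ2 _) hψ hψc] using t2

lemma radial_contDiff {N : ℕ} {n : WithTop ℕ∞} {P : ℝ → ℝ} (hP : ContDiff ℝ n P) {a c : ℝ}
    (ha : 0 < a) (hc : ∀ r < a, P r = c) : ContDiff ℝ n (fun x : E N => P ‖x‖) := by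
  rw [contDiff_iff_contDiffAt]
  intro x
  by_cases hx : x = 0
  · subst hx
    have : (fun x : E N => P ‖x‖) =ᶠ[𝓝 0] fun _ => c := by
      filter_upwards [Metric.ball_mem_nhds (0 : E N) ha] with y hy
      exact hc _ (by simpa using hy)
    exact contDiffAt_const.congr_of_eventuallyEq this
  · exact hP.contDiffAt.comp x (contDiffAt_norm ℝ hx)

lemma radial_fderiv {N : ℕ} {P : ℝ → ℝ} (hP : Differentiable ℝ P) {a c : ℝ}
    (ha : 0 < a) (hc : ∀ r < a, P r = c) (x : E N) (i : Fin N) :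
    fderiv ℝ (fun x : E N => P ‖x‖) x (EuclideanSpace.single i 1) = deriv P ‖x‖ / ‖x‖ * x i := by
  by_cases hx : x = 0
  · subst hx
    have : (fun x : E N => P ‖x‖) =ᶠ[𝓝 0] fun _ => c := by
      filter_upwards [Metric.ball_mem_nhds (0 : E N) ha] with y hy
      exact hc _ (by simpa using hy)
    rw [this.fderiv_eq]; simp
  · have hx' : ‖x‖ ≠ 0 := norm_ne_zero_iff.mpr hx
    have h1 : HasFDerivAt (fun y : E N => ‖y‖ ^ 2) (2 • (innerSL ℝ x)) x := by
      simpa using (hasStrictFDerivAt_norm_sq x).hasFDerivAt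
    have h2 := h1.sqrt (by positivity)
    have h3 : (fun y : E N => √(‖y‖ ^ 2)) = fun y => ‖y‖ := by
      ext y; exact Real.sqrt_sq (norm_nonneg y)
    rw [h3] at h2
    have h4 := (hP ‖x‖).hasDerivAt.comp_hasFDerivAt x h2
    have h5 := h4.fderiv
    simp only [Function.comp_def] at h5
    rw [h5]
    simp only [Real.sqrt_sq (norm_nonneg x)]
    simp [EuclideanSpace.inner_single_right]
    field_simp

lemma lapl_radial {N : ℕ} {P Q : ℝ → ℝ} (hP : Differentiable ℝ P) (hQ : Differentiable ℝ Q)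
    (hPQ : ∀ r, deriv P r = r * Q r) {a c : ℝ}
    (ha : 0 < a) (hc : ∀ r < a, P r = c) (hQ0 : ∀ r < a, Q r = 0) (x : E N) :
    lapl (fun x : E N => P ‖x‖) x = ‖x‖ * deriv Q ‖x‖ + N * Q ‖x‖ := by
  unfold lapl
  have h1 : ∀ i : Fin N, (fun y : E N => fderiv ℝ (fun x : E N => P ‖x‖) y
      (EuclideanSpace.single i 1)) = fun y => Q ‖y‖ * y i := by
    intro i; ext y
    rw [radial_fderiv hP ha hc, hPQ]
    by_cases hy : y = 0
    · subst hy; simp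
    · have : ‖y‖ ≠ 0 := norm_ne_zero_iff.mpr hy
      field_simp
  have hQd : DifferentiableAt ℝ (fun y : E N => Q ‖y‖) x := by
    by_cases hx : x = 0
    · subst hx
      have : (fun x : E N => Q ‖x‖) =ᶠ[𝓝 0] fun _ => 0 := by
        filter_upwards [Metric.ball_mem_nhds (0 : E N) ha] with y hy
        exact hQ0 _ (by simpa using hy)
      exact (differentiableAt_const _).congr_of_eventuallyEq this
    · exact (hQ ‖x‖).comp x ((contDiffAt_norm ℝ hx (n := 1)).differentiableAt (by norm_num))
  have h2 : ∀ i : Fin N, fderiv ℝ (fun y : E N => Q ‖y‖ * y i) x (EuclideanSpace.single i 1)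
      = deriv Q ‖x‖ / ‖x‖ * (x i)^2 + Q ‖x‖ := by
    intro i
    have hl : HasFDerivAt (fun y : E N => y i) (EuclideanSpace.proj i : E N →L[ℝ] ℝ) x :=
      (EuclideanSpace.proj i : E N →L[ℝ] ℝ).hasFDerivAt
    have hm : HasFDerivAt (fun y : E N => Q ‖y‖ * y i) _ x := hQd.hasFDerivAt.mul hl
    rw [hm.fderiv]
    simp only [add_apply, smul_apply, smul_eq_mul, radial_fderiv hQ ha hQ0]
    simp
    ring
  simp_rw [h1, h2]
  rw [Finset.sum_add_distrib, ← Finset.mul_sum]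
  have : ∑ i : Fin N, (x i)^2 = ‖x‖^2 := by rw [EuclideanSpace.norm_sq_eq]; simp
  rw [this]
  simp
  by_cases hx : ‖x‖ = 0
  · simp [hx]
  · field_simp

/-- The radial test function attached to a one dimensional test function. -/
lemma exists_test (N : ℕ) (hN : 5 ≤ N) {θ : ℝ → ℝ} (hθ : ContDiff ℝ 1 θ) {a b : ℝ} (ha : 0 < a)
    (hab : a < b) (h0 : ∀ r, 0 ≤ θ r) (h1 : ∀ r, θ r ≤ 1) (hza : ∀ r ≤ a, θ r = 0)
    (hzb : ∀ r, b ≤ r → θ r = 0) :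
    ∃ P : ℝ → ℝ, ContDiff ℝ 2 (fun x : E N => P ‖x‖) ∧
      (∀ r, b ≤ r → P r = 0) ∧ (∀ r, |P r| ≤ (b - a) * (a ^ (N - 1))⁻¹) ∧
      ∀ x : E N, 0 < ‖x‖ →
        lapl (fun x : E N => P ‖x‖) x = - (‖x‖ ^ (N - 1))⁻¹ * deriv θ ‖x‖ := by
  set Q : ℝ → ℝ := fun r => - (θ r / r ^ N) with hQdef
  have hQ0 : ∀ r < a, Q r = 0 := fun r hr => by simp [hQdef, hza r hr.le]
  have hQ : ContDiff ℝ 1 Q := by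
    rw [contDiff_iff_contDiffAt]
    intro r
    by_cases hr : r < a
    · have : Q =ᶠ[𝓝 r] fun _ => 0 := by
        filter_upwards [Iio_mem_nhds hr] with y hy
        exact hQ0 y hy
      exact contDiffAt_const.congr_of_eventuallyEq this
    · have hr0 : r ≠ 0 := by linarith
      exact (hθ.contDiffAt.div (contDiff_id.pow N).contDiffAt (pow_ne_zero _ hr0)).neg
  set k : ℝ → ℝ := fun s => s * Q s with hk
  have hkc : Continuous k := continuous_id.mul hQ.continuous
  have hk0 : ∀ r ≤ a, k r = 0 := fun r hr => by simp [hk, hQdef, hza r hr]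
  have hkb : ∀ r, b ≤ r → k r = 0 := fun r hr => by simp [hk, hQdef, hzb r hr]
  set P : ℝ → ℝ := fun r => ∫ s in b..r, k s with hPdef
  have hPd : ∀ r, HasDerivAt P (k r) r := fun r =>
    intervalIntegral.integral_hasDerivAt_right (hkc.intervalIntegrable _ _)
      (hkc.stronglyMeasurableAtFilter _ _) hkc.continuousAt
  have hPdiff : Differentiable ℝ P := fun r => (hPd r).differentiableAt
  have hPder : ∀ r, deriv P r = r * Q r := fun r => (hPd r).deriv
  have hPa : ∀ r < a, P r = P a := by
    intro r hr
    have : P a - P r = 0 := by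
      simp only [hPdef]
      rw [intervalIntegral.integral_interval_sub_left (hkc.intervalIntegrable _ _)
        (hkc.intervalIntegrable _ _)]
      rw [intervalIntegral.integral_congr (g := fun _ => (0:ℝ))]
      · simp
      · intro s hs
        rw [uIcc_of_le hr.le] at hs
        exact hk0 s hs.2
    linarith
  have hPb : ∀ r, b ≤ r → P r = 0 := by
    intro r hr
    simp only [hPdef]
    rw [intervalIntegral.integral_congr (g := fun _ => (0:ℝ))]
    · simp
    · intro s hs
      rw [uIcc_of_le hr] at hs
      exact hkb s hs.1
  have hkbd : ∀ s, a ≤ s → ‖k s‖ ≤ (a ^ (N - 1))⁻¹ := by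
    intro s hs
    have hs0 : 0 < s := by linarith
    have : k s = - (θ s * (s ^ (N-1))⁻¹) := by
      simp only [hk, hQdef]
      have : s ^ N = s ^ (N - 1) * s := by rw [← pow_succ]; congr 1; omega
      rw [this]; field_simp
    rw [this, norm_neg, Real.norm_eq_abs, abs_of_nonneg (mul_nonneg (h0 s) (by positivity))]
    calc θ s * (s ^ (N-1))⁻¹ ≤ 1 * (a ^ (N-1))⁻¹ := by
          gcongr
          exact h1 s
      _ = _ := one_mul _
  have hPbd1 : ∀ r, a ≤ r → r ≤ b → |P r| ≤ (b - a) * (a ^ (N - 1))⁻¹ := by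
    intro r har hrb
    have := intervalIntegral.norm_integral_le_of_norm_le_const (a := b) (b := r) (f := k)
      (C := (a ^ (N - 1))⁻¹) (by
        intro s hs
        rw [uIoc_comm, uIoc_of_le hrb] at hs
        exact hkbd s (by linarith [hs.1]))
    rw [Real.norm_eq_abs] at this
    refine this.trans ?_
    rw [mul_comm, abs_sub_comm, abs_of_nonneg (by linarith)]
    gcongr
  have hpos : 0 ≤ (b - a) * (a ^ (N - 1))⁻¹ := mul_nonneg (by linarith) (by positivity)
  refine ⟨P, ?_, hPb, ?_, ?_⟩
  · apply radial_contDiff _ ha hPa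
    have : (2 : WithTop ℕ∞) = 1 + 1 := by norm_num
    rw [this, contDiff_succ_iff_deriv]
    refine ⟨hPdiff, by simp, ?_⟩
    have : deriv P = fun r => r * Q r := funext hPder
    rw [this]
    exact contDiff_id.mul hQ
  · intro r
    rcases lt_or_ge r a with h | h
    · rw [hPa r h]; exact hPbd1 a le_rfl hab.le
    · rcases le_total r b with h' | h'
      · exact hPbd1 r h h'
      · rw [hPb r h']; simpa using hpos
  · intro x hx
    rw [lapl_radial hPdiff (hQ.differentiable (by norm_num)) hPder ha hPa hQ0]
    have hd : HasDerivAt Q (-((deriv θ ‖x‖ * ‖x‖ ^ N - θ ‖x‖ * (N * ‖x‖ ^ (N-1))) /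
        (‖x‖ ^ N) ^ 2)) ‖x‖ :=
      (((hθ.differentiable (by norm_num)) ‖x‖).hasDerivAt.div (hasDerivAt_pow N ‖x‖)
        (by positivity)).neg
    rw [hd.deriv]
    simp only [hQdef]
    have : ‖x‖ ^ N = ‖x‖ ^ (N - 1) * ‖x‖ := by rw [← pow_succ]; congr 1; omega
    rw [this]
    have h3 : ‖x‖ ^ (N-1) ≠ 0 := by positivity
    field_simp
    ring

/-- Test bound: the weak derivative of the profile is controlled. -/
lemma test_bound {N : ℕ} (hN : 5 ≤ N) {u w : E N → ℝ} {f : ℝ → ℝ} (h : MemD22 N u w)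
    (hw : ∫⁻ x : E N, ENNReal.ofReal ((w x) ^ 2) ≤ 1) (hf : ∀ x, u x = f ‖x‖)
    {θ : ℝ → ℝ} (hθ : ContDiff ℝ 1 θ) {a b : ℝ} (ha : 0 < a)
    (hab : a < b) (h0 : ∀ r, 0 ≤ θ r) (h1 : ∀ r, θ r ≤ 1) (hza : ∀ r ≤ a, θ r = 0)
    (hzb : ∀ r, b ≤ r → θ r = 0) :
    N * volume.real (Metric.ball (0 : E N) 1) * |∫ r in Ioi 0, f r * deriv θ r| ≤
      (b - a) * (a ^ (N - 1))⁻¹ * (volume.real (Metric.closedBall (0 : E N) b)) ^ (1/2 : ℝ) := by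
  have : Nontrivial (E N) := by
    have : Nonempty (Fin N) := ⟨⟨0, by omega⟩⟩
    infer_instance
  obtain ⟨P, hP, hPb, hPbd, hlap⟩ := exists_test N hN hθ ha hab h0 h1 hza hzb
  set M := (b - a) * (a ^ (N - 1))⁻¹ with hM
  have hM0 : 0 ≤ M := (abs_nonneg _).trans (hPbd 0)
  have hPc : HasCompactSupport (fun x : E N => P ‖x‖) := by
    refine HasCompactSupport.intro (isCompact_closedBall (0 : E N) b) ?_
    intro x hx
    apply hPb
    simp at hx
    exact hx.le
  have hweak := weak_lapl hN h hP hPc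
  have e1 : ∫ x, u x * lapl (fun x : E N => P ‖x‖) x =
      - (N * volume.real (Metric.ball (0 : E N) 1) * ∫ r in Ioi 0, f r * deriv θ r) := by
    have e2 : ∫ x, u x * lapl (fun x : E N => P ‖x‖) x =
        ∫ x : E N, (fun r => - (f r * ((r ^ (N - 1))⁻¹ * deriv θ r))) ‖x‖ := by
      apply integral_congr_ae
      have : ∀ᵐ x : E N, x ≠ 0 := by
        simp [ae_iff, measure_singleton]
      filter_upwards [this] with x hx
      rw [hlap x (norm_pos_iff.mpr hx), hf x]; ring
    rw [e2]
    refine (integral_fun_norm_addHaar (volume : Measure (E N))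
      (fun r => - (f r * ((r ^ (N - 1))⁻¹ * deriv θ r)))).trans ?_
    simp only [finrank_euclideanSpace, Fintype.card_fin, smul_eq_mul, nsmul_eq_mul]
    rw [setIntegral_congr_fun (g := fun r => - (f r * deriv θ r)) measurableSet_Ioi]
    · rw [integral_neg]; ring
    · intro r hr
      have hr' : (0:ℝ) < r := hr
      have : r ^ (N-1) ≠ 0 := by positivity
      simp only; field_simp
  have e3 : |∫ x, w x * P ‖x‖| ≤
      M * (volume.real (Metric.closedBall (0 : E N) b)) ^ (1/2 : ℝ) := by
    have hwm : AEStronglyMeasurable w volume := h.2.1.1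
    have hw2 : eLpNorm w 2 volume ≤ 1 := by
      rw [eLpNorm_eq_lintegral_rpow_enorm_toReal (by norm_num) (by norm_num)]
      have : ∀ x, ‖w x‖ₑ ^ (2:ℝ≥0∞).toReal = ENNReal.ofReal ((w x)^2) := by
        intro x
        rw [← ofReal_norm, Real.norm_eq_abs, ENNReal.ofReal_rpow_of_nonneg (abs_nonneg _) (by simp)]
        simp
      simp_rw [this]
      exact ENNReal.rpow_le_one hw (by simp)
    set B := Metric.closedBall (0 : E N) b
    have hBf : volume B ≠ ⊤ := (isCompact_closedBall (0 : E N) b).measure_ne_top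
    have : ‖∫ x, w x * P ‖x‖‖ₑ ≤ ENNReal.ofReal M * volume B ^ (1/2 : ℝ) := by
      calc ‖∫ x, w x * P ‖x‖‖ₑ ≤ ∫⁻ x, ‖w x * P ‖x‖‖ₑ := enorm_integral_le_lintegral_enorm _
        _ ≤ ∫⁻ x, B.indicator (fun x => ENNReal.ofReal M * ‖w x‖ₑ) x := by
          apply lintegral_mono
          intro x
          by_cases hx : x ∈ B
          · simp only [indicator_of_mem hx, enorm_mul]
            rw [mul_comm]
            gcongr
            rw [← ofReal_norm]
            exact ENNReal.ofReal_le_ofReal (hPbd _)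
          · have : b ≤ ‖x‖ := by simp [B] at hx; exact hx.le
            simp [hPb _ this]
        _ = ENNReal.ofReal M * eLpNorm w 1 (volume.restrict B) := by
          rw [lintegral_indicator measurableSet_closedBall,
            lintegral_const_mul' _ _ (by finiteness), eLpNorm_one_eq_lintegral_enorm]
        _ ≤ ENNReal.ofReal M * (eLpNorm w 2 (volume.restrict B) *
            (volume.restrict B) univ ^ (1 / (1:ℝ≥0∞).toReal - 1 / (2:ℝ≥0∞).toReal)) := by
          gcongr
          exact eLpNorm_le_eLpNorm_mul_rpow_measure_univ (by norm_num) hwm.restrict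
        _ ≤ ENNReal.ofReal M * (1 * volume B ^ (1/2:ℝ)) := by
          have : (1 / (1:ℝ≥0∞).toReal - 1 / (2:ℝ≥0∞).toReal) = 1/2 := by norm_num
          rw [Measure.restrict_apply_univ, this]
          gcongr
          exact (eLpNorm_mono_measure _ Measure.restrict_le_self).trans hw2
        _ = _ := by rw [one_mul]
    have h3 := ENNReal.toReal_mono (by finiteness) this
    rw [ENNReal.toReal_mul, ENNReal.toReal_ofReal hM0, ← ENNReal.toReal_rpow, toReal_enorm,
      Real.norm_eq_abs] at h3
    exact h3
  rw [← hweak, e1, abs_neg, abs_mul, abs_of_nonneg (by positivity)] at e3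
  exact e3

/-- Difference of mollifications. -/
lemma moll_bound {N : ℕ} (hN : 5 ≤ N) {u w : E N → ℝ} {f : ℝ → ℝ} (h : MemD22 N u w)
    (hw : ∫⁻ x : E N, ENNReal.ofReal ((w x) ^ 2) ≤ 1) (hf : ∀ x, u x = f ‖x‖)
    (ρ : ContDiffBump (0 : ℝ)) {s t : ℝ} (hs : ρ.rOut < s) (hst : s < t) :
    N * volume.real (Metric.ball (0 : E N) 1) *
      |∫ r in Ioi 0, f r * (ρ.normed volume (r - s) - ρ.normed volume (r - t))| ≤
      (t + ρ.rOut - (s - ρ.rOut)) * ((s - ρ.rOut) ^ (N - 1))⁻¹ *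
        (volume.real (Metric.closedBall (0 : E N) (t + ρ.rOut))) ^ (1/2 : ℝ) := by
  set g := ρ.normed (volume : Measure ℝ) with hg
  have hgc : Continuous g := ρ.continuous_normed
  have hg0 : ∀ x, 0 ≤ g x := ρ.nonneg_normed
  have hgi : Integrable g := ρ.integrable_normed
  have hsupp : ∀ x, ρ.rOut ≤ |x| → g x = 0 := by
    intro x hx
    by_contra hne
    have : x ∈ Function.support g := hne
    rw [hg, ρ.support_normed_eq] at this
    simp at this; linarith
  have hpos := ρ.rOut_pos
  set F : ℝ → ℝ := fun y => ∫ z in (-ρ.rOut)..y, g z with hF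
  have hFd : ∀ y, HasDerivAt F (g y) y := fun r =>
    intervalIntegral.integral_hasDerivAt_right (hgc.intervalIntegrable _ _)
      (hgc.stronglyMeasurableAtFilter _ _) hgc.continuousAt
  have hFmono : Monotone F := monotone_of_hasDerivAt_nonneg hFd (fun y => hg0 y)
  have hF0 : ∀ y ≤ -ρ.rOut, F y = 0 := by
    intro y hy
    simp only [hF]
    rw [intervalIntegral.integral_congr (g := fun _ => (0:ℝ))]
    · simp
    · intro z hz
      rw [uIcc_of_ge hy] at hz
      apply hsupp
      rw [abs_of_nonpos (by linarith [hz.2])]; linarith [hz.2]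
  have hF1 : ∀ y, ρ.rOut ≤ y → F y = 1 := by
    intro y hy
    have hle : -ρ.rOut ≤ y := by linarith
    simp only [hF]
    rw [intervalIntegral.integral_of_le hle, setIntegral_eq_integral_of_forall_compl_eq_zero,
      ρ.integral_normed]
    intro z hz
    apply hsupp
    simp only [mem_Ioc, not_and_or, not_lt, not_le] at hz
    rcases hz with hz | hz
    · rw [abs_of_nonpos (by linarith)]; linarith
    · rw [abs_of_pos (by linarith)]; linarith
  have hFge : ∀ y, 0 ≤ F y := by
    intro y
    rcases le_total y (-ρ.rOut) with hy | hy
    · rw [hF0 y hy]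
    · rw [← hF0 _ le_rfl]; exact hFmono hy
  have hFle : ∀ y, F y ≤ 1 := by
    intro y
    rcases le_total y (ρ.rOut) with hy | hy
    · rw [← hF1 _ le_rfl]; exact hFmono hy
    · rw [hF1 y hy]
  set θ : ℝ → ℝ := fun y => F (y - s) - F (y - t) with hθ
  have hθd : ∀ y, HasDerivAt θ (g (y - s) - g (y - t)) y := fun y =>
    ((hFd (y - s)).comp_sub_const y s).sub ((hFd (y - t)).comp_sub_const y t)
  have hderiv : deriv θ = fun y => g (y - s) - g (y - t) := funext fun y => (hθd y).deriv
  have hθc : ContDiff ℝ 1 θ := by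
    rw [contDiff_one_iff_deriv]
    refine ⟨fun y => (hθd y).differentiableAt, ?_⟩
    rw [hderiv]; fun_prop
  have := test_bound hN h hw hf hθc (a := s - ρ.rOut) (b := t + ρ.rOut) (by linarith) (by linarith)
    (fun r => sub_nonneg.mpr (hFmono (by linarith)))
    (fun r => by simp only [hθ]; linarith [hFle (r - s), hFge (r - t)])
    (fun r hr => by simp only [hθ]; rw [hF0 _ (by linarith), hF0 _ (by linarith), sub_zero])
    (fun r hr => by simp only [hθ]; rw [hF1 _ (by linarith), hF1 _ (by linarith), sub_self])
  rw [hderiv] at this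
  exact this

lemma profile_integrable {N : ℕ} (hN : 5 ≤ N) {u : E N → ℝ} {f : ℝ → ℝ}
    (h : MemLp u (twoSS N) volume) (hf : ∀ x, u x = f ‖x‖) {a b : ℝ} (ha : 0 < a) :
    Integrable ((Ioo a b).indicator f) := by
  have : Nontrivial (E N) := by
    have : Nonempty (Fin N) := ⟨⟨0, by omega⟩⟩
    infer_instance
  have hl : LocallyIntegrable u volume := h.locallyIntegrable (one_le_twoSS N hN)
  have h1 : IntegrableOn (fun x : E N => f ‖x‖) (Metric.ball 0 b) volume := by
    have := (hl.integrableOn_isCompact (isCompact_closedBall (0 : E N) b)).mono_set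
      Metric.ball_subset_closedBall
    refine this.congr_fun (fun x _ => hf x) measurableSet_ball
  rw [integrableOn_fun_norm_addHaar] at h1
  simp only [finrank_euclideanSpace, Fintype.card_fin, smul_eq_mul] at h1
  rw [integrable_indicator_iff measurableSet_Ioo]
  have h2 : IntegrableOn (fun y => y ^ (N-1) * f y) (Ioo a b) :=
    h1.mono_set (Ioo_subset_Ioo_left ha.le)
  have h3 : IntegrableOn (fun y => (y ^ (N-1))⁻¹ * (y ^ (N-1) * f y)) (Ioo a b) := by
    refine Integrable.bdd_mul (c := (a ^ (N-1))⁻¹) h2 ?_ ?_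
    · exact ((measurable_id.pow_const _).inv).aestronglyMeasurable
    · filter_upwards [ae_restrict_mem measurableSet_Ioo] with y hy
      have : 0 < y := ha.trans hy.1
      rw [Real.norm_eq_abs, abs_of_pos (by positivity)]
      gcongr
      exact hy.1.le
  refine h3.congr_fun ?_ measurableSet_Ioo
  intro y hy
  have : 0 < y := ha.trans hy.1
  simp only; field_simp

lemma profile_lip {N : ℕ} (hN : 5 ≤ N) {u w : E N → ℝ} {f : ℝ → ℝ} (h : MemD22 N u w)
    (hw : ∫⁻ x : E N, ENNReal.ofReal ((w x) ^ 2) ≤ 1) (hf : ∀ x, u x = f ‖x‖) :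
    ∃ G : Set ℝ, (∀ᵐ t, t ∈ G) ∧ ∀ s ∈ G, ∀ t ∈ G, 0 < s → s < t →
      N * volume.real (Metric.ball (0 : E N) 1) * |f t - f s| ≤
        (t - s) * (s ^ (N - 1))⁻¹ *
        (t ^ N * volume.real (Metric.ball (0 : E N) 1)) ^ (1/2 : ℝ) := by
  have : Nontrivial (E N) := by
    have : Nonempty (Fin N) := ⟨⟨0, by omega⟩⟩
    infer_instance
  let φ : ℕ → ContDiffBump (0 : ℝ) := fun i =>
    { rIn := 1 / ((i:ℝ) + 1), rOut := 2 * (1 / ((i:ℝ) + 1)), rIn_pos := by positivity,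
      rIn_lt_rOut := by
        have : 0 < 1 / ((i:ℝ) + 1) := by positivity
        linarith }
  have hφ : Tendsto (fun i => (φ i).rOut) atTop (𝓝 0) := by
    have := (tendsto_one_div_add_atTop_nhds_zero_nat (𝕜 := ℝ)).const_mul 2
    rw [mul_zero] at this
    exact this
  let g : ℕ → ℝ → ℝ := fun m => (Ioo (1 / ((m:ℝ) + 1)) ((m:ℝ) + 1)).indicator f
  have hgi : ∀ m, Integrable (g m) := fun m => profile_integrable hN h.1 hf (by positivity)
  refine ⟨{t | ∀ m, Tendsto (fun i => (convolution ((φ i).normed volume) (g m)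
    (ContinuousLinearMap.lsmul ℝ ℝ) volume) t) atTop (𝓝 (g m t))}, ?_, ?_⟩
  · simp only [mem_ofPred_eq]
    rw [ae_all_iff]
    intro m
    exact ContDiffBump.ae_convolution_tendsto_right_of_locallyIntegrable (K := 2) hφ
      (Eventually.of_forall fun i => le_rfl) (hgi m).locallyIntegrable
  · intro s hs t ht hs0 hst
    obtain ⟨m, hm1, hm2⟩ : ∃ m : ℕ, 1 / ((m:ℝ) + 1) < s ∧ t < m + 1 := by
      have e1 := (tendsto_one_div_add_atTop_nhds_zero_nat (𝕜 := ℝ)).eventually_lt_const hs0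
      have e2 := (tendsto_natCast_atTop_atTop (R := ℝ)).eventually_gt_atTop t
      obtain ⟨m, h1, h2⟩ := (e1.and e2).exists
      exact ⟨m, h1, by linarith⟩
    have hm0 : 0 < 1 / ((m:ℝ) + 1) := by positivity
    have hgs : g m s = f s := indicator_of_mem (mem_Ioo.mpr ⟨hm1, by linarith⟩) f
    have hgt : g m t = f t := indicator_of_mem (mem_Ioo.mpr ⟨by linarith, hm2⟩) f
    have l1 := hs m
    have l2 := ht m
    rw [hgs] at l1
    rw [hgt] at l2
    have hL := ((l2.sub l1).abs).const_mul (N * volume.real (Metric.ball (0 : E N) 1))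
    have hR : Tendsto (fun i => (t + (φ i).rOut - (s - (φ i).rOut)) *
        ((s - (φ i).rOut) ^ (N - 1))⁻¹ *
        ((t + (φ i).rOut) ^ N * volume.real (Metric.ball (0 : E N) 1)) ^ (1/2 : ℝ)) atTop
        (𝓝 ((t + 0 - (s - 0)) * ((s - 0) ^ (N - 1))⁻¹ *
        ((t + 0) ^ N * volume.real (Metric.ball (0 : E N) 1)) ^ (1/2 : ℝ))) := by
      have a1 : Tendsto (fun i => t + (φ i).rOut) atTop (𝓝 (t + 0)) := hφ.const_add t
      have a2 : Tendsto (fun i => s - (φ i).rOut) atTop (𝓝 (s - 0)) := hφ.const_sub s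
      refine ((a1.sub a2).mul ((a2.pow _).inv₀ ?_)).mul
        (((a1.pow _).mul_const _).rpow_const (Or.inr (by norm_num)))
      rw [sub_zero]; positivity
    simp only [add_zero, sub_zero] at hR
    refine le_of_tendsto_of_tendsto hL hR ?_
    have ev1 := hφ.eventually_lt_const (show 0 < s - 1 / ((m:ℝ) + 1) by linarith)
    have ev2 := hφ.eventually_lt_const (show 0 < (m:ℝ) + 1 - t by linarith)
    filter_upwards [ev1, ev2] with i hi1 hi2
    have hb := moll_bound hN h hw hf (φ i) (s := s) (t := t) (by linarith) hst
    have hpos := (φ i).rOut_pos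
    rw [Measure.addHaar_real_closedBall _ _ (by linarith)] at hb
    simp only [finrank_euclideanSpace, Fintype.card_fin] at hb
    refine le_trans (le_of_eq ?_) hb
    congr 1
    set ρ := (φ i).normed (volume : Measure ℝ) with hρ
    have hsupp : ∀ x, (φ i).rOut ≤ |x| → ρ x = 0 := by
      intro x hx
      by_contra hne
      have : x ∈ Function.support ρ := hne
      rw [hρ, (φ i).support_normed_eq] at this
      simp at this; linarith
    have hρc : Continuous ρ := (φ i).continuous_normed
    obtain ⟨M, hM⟩ := hρc.bounded_above_of_compact_support (φ i).hasCompactSupport_normed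
    have hIntg : ∀ c, Integrable (fun z => ρ (c - z) * g m z) := fun c =>
      Integrable.bdd_mul (c := M) (hgi m)
        (hρc.comp (continuous_const.sub continuous_id)).aestronglyMeasurable
        (Eventually.of_forall fun z => hM _)
    have hsym : ∀ c z, ρ (c - z) = ρ (z - c) := fun c z => by
      rw [hρ, ← (φ i).normed_neg]; congr 1; ring
    simp only [convolution_eq_swap, ContinuousLinearMap.lsmul_apply, smul_eq_mul]
    rw [abs_sub_comm, ← integral_sub (hIntg s) (hIntg t), ← integral_indicator measurableSet_Ioi]
    congr 1
    apply integral_congr_ae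
    refine Eventually.of_forall fun z => ?_
    simp only [hsym s z, hsym t z]
    by_cases hz : z ∈ Ioo (1 / ((m:ℝ) + 1)) ((m:ℝ) + 1)
    · have hgz : g m z = f z := indicator_of_mem hz f
      have hz0 : z ∈ Ioi (0:ℝ) := hm0.trans hz.1
      rw [indicator_of_mem hz0, hgz]; ring
    · have hgz : g m z = 0 := indicator_of_notMem hz f
      have hz' : z ≤ 1 / ((m:ℝ) + 1) ∨ (m:ℝ) + 1 ≤ z := by
        by_contra hcon
        push Not at hcon
        exact hz hcon
      have h1 : ρ (z - s) = 0 := by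
        apply hsupp
        rcases hz' with h | h
        · rw [abs_of_neg (by linarith)]; linarith
        · rw [abs_of_pos (by linarith)]; linarith
      have h2 : ρ (z - t) = 0 := by
        apply hsupp
        rcases hz' with h | h
        · rw [abs_of_neg (by linarith)]; linarith
        · rw [abs_of_pos (by linarith)]; linarith
      rw [hgz]
      by_cases hz0 : z ∈ Ioi (0:ℝ)
      · rw [indicator_of_mem hz0, h1, h2]; ring
      · rw [indicator_of_notMem hz0]; ring

lemma ae_norm {N : ℕ} (hN : 5 ≤ N) {p : ℝ → Prop} (h : ∀ᵐ r : ℝ, 0 < r → p r) :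
    ∀ᵐ x : E N, p ‖x‖ := by
  have : Nontrivial (E N) := by
    have : Nonempty (Fin N) := ⟨⟨0, by omega⟩⟩
    infer_instance
  set S := toMeasurable volume {r : ℝ | ¬ (0 < r → p r)} with hS
  have hS0 : volume S = 0 := by rw [hS, measure_toMeasurable]; exact h
  have hSae : ∀ᵐ r : ℝ, r ∉ S := measure_eq_zero_iff_ae_notMem.mp hS0
  have hz : (fun y : ℝ => y ^ (Module.finrank ℝ (E N) - 1) • S.indicator (fun _ => (1:ℝ)) y)
      =ᵐ[volume.restrict (Ioi 0)] fun _ => 0 := by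
    filter_upwards [ae_restrict_of_ae hSae] with r hr
    simp [hr]
  have hi : Integrable (fun x : E N => S.indicator (fun _ => (1:ℝ)) ‖x‖) volume := by
    rw [integrable_fun_norm_addHaar (volume : Measure (E N)) (f := S.indicator (fun _ => (1:ℝ)))]
    exact (integrable_zero _ _ _).congr hz.symm
  have h0 := integral_fun_norm_addHaar (volume : Measure (E N)) (S.indicator (fun _ => (1:ℝ)))
  rw [integral_congr_ae hz] at h0
  simp only [integral_zero, smul_zero] at h0
  rw [integral_eq_zero_iff_of_nonneg (fun x => indicator_nonneg (fun _ _ => zero_le_one) _) hi] at h0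
  have hne : ∀ᵐ x : E N, x ≠ 0 := by simp [ae_iff, measure_singleton]
  filter_upwards [h0, hne] with x hx hx0
  have hxS : ‖x‖ ∉ S := by
    intro hmem
    simp [hmem] at hx
  by_contra hp
  apply hxS
  apply subset_toMeasurable
  intro hcon
  exact hp (hcon (norm_pos_iff.mpr hx0))

lemma pointwise_real {N : ℕ} {γ D κ t : ℝ} {f : ℝ → ℝ} (hγ : 4 ≤ γ) (hD : 0 ≤ D)
    (hκ : 0 < κ) (hN : 5 ≤ N) {R2 : ℝ} (hR2 : R2 ≤ 1) (ht0 : 0 < t) (htR : t < R2)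
    (hIntg : IntegrableOn (fun s => s ^ (N-1) * (s ^ (-γ) * (f s)^2)) (Ioo 0 R2))
    (hintD : ∫ s in Ioo 0 R2, s ^ (N-1) * (s ^ (-γ) * (f s)^2) ≤ D)
    (hlip : ∀ᵐ s, 0 < s → s < t → N * κ * |f t - f s| ≤ (t - s) * (s ^ (N - 1))⁻¹ *
        (t ^ N * κ) ^ (1/2 : ℝ)) :
    (f t)^2 ≤ (4 * 2 ^ (N-1) * D + (2 ^ (N-1) * κ ^ (1/2:ℝ) / (N * κ))^2) * t ^ (γ/2 + 2 - N) := by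
  have ht1 : t ≤ 1 := by linarith
  have hNpos : (0:ℝ) < N := by positivity
  set δ := t ^ (γ/4) / 2 with hδ
  have hδ0 : 0 < δ := by positivity
  have hδt : δ ≤ t / 2 := by
    have : t ^ (γ/4) ≤ t ^ (1:ℝ) := Real.rpow_le_rpow_of_exponent_ge ht0 ht1 (by linarith)
    rw [Real.rpow_one] at this
    rw [hδ]; linarith
  set C1 := 2 ^ (N-1) * κ ^ (1/2:ℝ) / (N * κ) with hC1
  set L := C1 * t ^ (1 - (N:ℝ)/2) with hL
  set W := (2:ℝ) ^ (N-1) * t ^ (γ - ((N:ℝ) - 1)) with hW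
  have hW0 : 0 < W := by positivity
  have hcast : ((N - 1 : ℕ) : ℝ) = (N:ℝ) - 1 := by
    rw [Nat.cast_sub (by omega)]; simp
  have hinv : ∀ s, t/2 ≤ s → (s ^ (N-1))⁻¹ ≤ 2 ^ (N-1) * t ^ (-((N:ℝ) - 1)) := by
    intro s hs
    calc (s ^ (N-1))⁻¹ ≤ ((t/2) ^ (N-1))⁻¹ := by gcongr
      _ = 2 ^ (N-1) * t ^ (-((N:ℝ) - 1)) := by
        rw [Real.rpow_neg ht0.le, ← hcast, Real.rpow_natCast, div_pow, inv_div]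
        ring
  have hk0 : ∀ s, 0 < s → 0 ≤ s ^ (N-1) * (s ^ (-γ) * (f s)^2) := fun s hs => by positivity
  have hpt : ∀ᵐ s, s ∈ Ioo (t - δ) t →
      (f t)^2 ≤ 2 * W * (s ^ (N-1) * (s ^ (-γ) * (f s)^2)) + 2 * L^2 * δ^2 := by
    filter_upwards [hlip] with s hs hsJ
    have hs2 : t/2 ≤ s := by linarith [hsJ.1]
    have hs0 : 0 < s := by linarith
    have h1 := hs hs0 hsJ.2
    have h2 : |f t - f s| ≤ L * δ := by
      have h3 : N * κ * |f t - f s| ≤ N * κ * (L * δ) := by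
        refine h1.trans ?_
        have e1 : (t ^ N * κ) ^ (1/2 : ℝ) = t ^ ((N:ℝ)/2) * κ ^ (1/2:ℝ) := by
          rw [Real.mul_rpow (by positivity) hκ.le, ← Real.rpow_natCast, ← Real.rpow_mul ht0.le]
          congr 2; ring
        have e2 : t ^ (1 - (N:ℝ)/2) = t ^ (-((N:ℝ) - 1)) * t ^ ((N:ℝ)/2) := by
          rw [← Real.rpow_add ht0]; congr 1; ring
        rw [e1]
        calc (t - s) * (s ^ (N - 1))⁻¹ * (t ^ ((N:ℝ)/2) * κ ^ (1/2:ℝ))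
            ≤ δ * (2 ^ (N-1) * t ^ (-((N:ℝ) - 1))) * (t ^ ((N:ℝ)/2) * κ ^ (1/2:ℝ)) := by
              gcongr
              · linarith [hsJ.1]
              · exact hinv s hs2
          _ = N * κ * (L * δ) := by
              rw [hL, hC1, e2]; field_simp
      exact le_of_mul_le_mul_left h3 (by positivity)
    have h4 : (f t)^2 ≤ 2 * (f s)^2 + 2 * (L * δ)^2 := by
      have h5 : (f t - f s)^2 ≤ (L*δ)^2 := by
        rw [← sq_abs]; gcongr
      nlinarith [sq_nonneg (f t - 2 * f s)]
    have h6 : (f s)^2 ≤ W * (s ^ (N-1) * (s ^ (-γ) * (f s)^2)) := by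
      have h7 : (f s)^2 = (s^γ * (s ^ (N-1))⁻¹) * (s ^ (N-1) * (s ^ (-γ) * (f s)^2)) := by
        rw [Real.rpow_neg hs0.le]; field_simp
      have h8 : s^γ * (s ^ (N-1))⁻¹ ≤ W := by
        calc s^γ * (s ^ (N-1))⁻¹ ≤ t^γ * (2 ^ (N-1) * t ^ (-((N:ℝ) - 1))) := by
              gcongr
              · exact hsJ.2.le
              · exact hinv s hs2
          _ = W := by
              rw [hW, sub_eq_add_neg γ, Real.rpow_add ht0]; ring
      calc (f s)^2 = (s^γ * (s ^ (N-1))⁻¹) * (s ^ (N-1) * (s ^ (-γ) * (f s)^2)) := h7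
        _ ≤ _ := mul_le_mul_of_nonneg_right h8 (hk0 s hs0)
    nlinarith [h4, h6]
  have hJ : Ioo (t - δ) t ⊆ Ioo 0 R2 := Ioo_subset_Ioo (by linarith) htR.le
  have hintJ := hIntg.mono_set hJ
  have hJv : volume.real (Ioo (t - δ) t) = δ := by
    simp [hδ0.le]
  have hmain : δ * (f t)^2 ≤ 2 * W * D + 2 * L^2 * δ^3 := by
    have h1 : ∫ s in Ioo (t - δ) t, (f t)^2 ≤ ∫ s in Ioo (t - δ) t,
        (2 * W * (s ^ (N-1) * (s ^ (-γ) * (f s)^2)) + 2 * L^2 * δ^2) := by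
      apply integral_mono_ae
      · exact integrable_const _
      · exact (hintJ.const_mul _).add (integrable_const _)
      · exact (ae_restrict_iff' measurableSet_Ioo).mpr hpt
    rw [integral_add (hintJ.const_mul _) (integrable_const _), integral_const_mul, setIntegral_const,
      setIntegral_const, hJv, smul_eq_mul, smul_eq_mul] at h1
    have h2 : ∫ s in Ioo (t - δ) t, s ^ (N-1) * (s ^ (-γ) * (f s)^2) ≤ D := by
      refine le_trans (setIntegral_mono_set hIntg ?_ hJ.eventuallyLE) hintD
      filter_upwards [ae_restrict_mem measurableSet_Ioo] with s hs
      exact hk0 s hs.1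
    have h3 := mul_le_mul_of_nonneg_left h2 (by positivity : 0 ≤ 2 * W)
    linarith
  have hdiv : (f t)^2 ≤ (2 * W * D) / δ + 2 * L^2 * δ^2 := by
    have : (f t)^2 = δ * (f t)^2 / δ := by field_simp
    rw [this]
    calc δ * (f t)^2 / δ ≤ (2 * W * D + 2 * L^2 * δ^3) / δ := by gcongr
      _ = _ := by field_simp
  have t1 : (2 * W * D) / δ ≤ 4 * 2 ^ (N-1) * D * t ^ (γ/2 + 2 - N) := by
    have e : (2 * W * D) / δ = 4 * 2 ^ (N-1) * D * t ^ (γ - ((N:ℝ) - 1) - γ/4) := by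
      rw [hW, hδ, Real.rpow_sub ht0 _ (γ/4)]; field_simp; ring
    rw [e]
    gcongr ?_ * ?_
    exact Real.rpow_le_rpow_of_exponent_ge ht0 ht1 (by linarith)
  have t2 : 2 * L^2 * δ^2 ≤ C1^2 * t ^ (γ/2 + 2 - N) := by
    have e : t ^ (γ/2 + 2 - N) = (t ^ (1 - (N:ℝ)/2))^2 * (t ^ (γ/4))^2 := by
      rw [← Real.rpow_natCast, ← Real.rpow_natCast, ← Real.rpow_mul ht0.le, ← Real.rpow_mul ht0.le,
        ← Real.rpow_add ht0]
      congr 1; push_cast; ring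
    rw [e, hL, hδ]
    have : 0 ≤ C1^2 * ((t ^ (1 - (N:ℝ)/2))^2 * (t ^ (γ/4))^2) := by positivity
    nlinarith
  calc (f t)^2 ≤ _ := hdiv
    _ ≤ _ := add_le_add t1 t2
    _ = _ := by ring

lemma pointwise_bound {N : ℕ} (hN : 5 ≤ N) {γ R2 c' : ℝ} (hγ : 4 ≤ γ) (hR2 : R2 ≤ 1)
    (hc' : 0 ≤ c') :
    ∃ C : ℝ, 0 ≤ C ∧ ∀ u w : E N → ℝ, MemD22 N u w → IsRadial u →
      (∫⁻ x, ENNReal.ofReal ((w x)^2)) ≤ 1 →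
      (∫⁻ x in Metric.ball (0 : E N) R2, ENNReal.ofReal (‖x‖ ^ (-γ) * (u x)^2))
        ≤ ENNReal.ofReal c' →
      ∀ᵐ x : E N, ‖x‖ < R2 → |u x| ≤ C * ‖x‖ ^ ((γ/2 + 2 - N)/2) := by
  have hne : Nonempty (Fin N) := ⟨⟨0, by omega⟩⟩
  have : Nontrivial (E N) := by infer_instance
  set κ := volume.real (Metric.ball (0 : E N) 1) with hκ
  have hκ0 : 0 < κ := by
    rw [hκ]
    exact ENNReal.toReal_pos (Metric.measure_ball_pos _ _ one_pos).ne' measure_ball_lt_top.ne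
  have hNpos : (0:ℝ) < N := by positivity
  set D := c' / (N * κ) with hD
  have hD0 : 0 ≤ D := by positivity
  set M := (4 * 2 ^ (N-1) * D + (2 ^ (N-1) * κ ^ (1/2:ℝ) / (N * κ))^2) with hM
  have hM0 : 0 ≤ M := by positivity
  refine ⟨Real.sqrt M, Real.sqrt_nonneg _, ?_⟩
  intro u w hu hrad hw hIntg
  let e : E N := EuclideanSpace.single (Classical.choice hne) 1
  have he : ‖e‖ = 1 := by simp [e]
  let f : ℝ → ℝ := fun r => u (r • e)
  have hf : ∀ x, u x = f ‖x‖ := fun x => hrad _ _ (by simp [norm_smul, he])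
  obtain ⟨G, hG, hlip⟩ := profile_lip hN hu hw hf
  have hum : AEStronglyMeasurable u volume := hu.1.1
  have hmeas : AEStronglyMeasurable (fun x : E N => ‖x‖ ^ (-γ) * (u x)^2)
      (volume.restrict (Metric.ball (0 : E N) R2)) := by
    refine AEStronglyMeasurable.mul ?_ ((hum.pow 2).restrict)
    exact (measurable_norm.pow_const _).aestronglyMeasurable
  have hnn : ∀ x : E N, 0 ≤ ‖x‖ ^ (-γ) * (u x)^2 := fun x => by positivity
  have hI : IntegrableOn (fun x : E N => ‖x‖ ^ (-γ) * (u x)^2) (Metric.ball (0 : E N) R2) := by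
    refine ⟨hmeas, ?_⟩
    rw [hasFiniteIntegral_iff_ofReal (Eventually.of_forall hnn)]
    exact hIntg.trans_lt ofReal_lt_top
  have hIv : ∫ x in Metric.ball (0 : E N) R2, ‖x‖ ^ (-γ) * (u x)^2 ≤ c' := by
    rw [integral_eq_lintegral_of_nonneg_ae (Eventually.of_forall hnn) hmeas]
    exact ENNReal.toReal_le_of_le_ofReal hc' hIntg
  let g : ℝ → ℝ := fun r => r ^ (-γ) * (f r)^2
  have hgx : (fun x : E N => ‖x‖ ^ (-γ) * (u x)^2) = fun x => g ‖x‖ := by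
    funext x; simp only [g]; rw [hf x]
  rw [hgx] at hI hIv
  have hI2 := (integrableOn_fun_norm_addHaar (volume : Measure (E N)) (f := g)).mp hI
  simp only [finrank_euclideanSpace, Fintype.card_fin, smul_eq_mul, g] at hI2
  have hIv2 : ∫ s in Ioo 0 R2, s ^ (N-1) * (s ^ (-γ) * (f s)^2) ≤ D := by
    have h1 := integral_fun_norm_addHaar (volume : Measure (E N)) ((Iio R2).indicator g)
    have h2 : (∫ x : E N, (Iio R2).indicator g ‖x‖) = ∫ x in Metric.ball (0 : E N) R2, g ‖x‖ := by
      rw [← integral_indicator measurableSet_ball]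
      congr 1; funext x; simp [indicator]
    have h3 : (∫ y in Ioi (0:ℝ), y ^ (Module.finrank ℝ (E N) - 1) • (Iio R2).indicator g y)
        = ∫ s in Ioo 0 R2, s ^ (N-1) * (s ^ (-γ) * (f s)^2) := by
      rw [← integral_indicator measurableSet_Ioi, ← integral_indicator measurableSet_Ioo]
      congr 1; funext y
      by_cases h0 : 0 < y <;> by_cases hy : y < R2 <;> simp [h0, hy, g]
    rw [h2, h3] at h1
    simp only [finrank_euclideanSpace, Fintype.card_fin, smul_eq_mul, nsmul_eq_mul] at h1
    rw [hD, le_div_iff₀ (by positivity)]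
    rw [h1] at hIv
    linarith
  have hreal : ∀ᵐ t : ℝ, 0 < t → (t < R2 → |f t| ≤ Real.sqrt M * t ^ ((γ/2 + 2 - N)/2)) := by
    filter_upwards [hG] with t ht ht0 htR
    have h := pointwise_real hγ hD0 hκ0 hN hR2 ht0 htR hI2 hIv2
      (by filter_upwards [hG] with s hs hs0 hst using hlip s hs t ht hs0 hst)
    rw [← hM] at h
    have h2 := Real.sqrt_le_sqrt h
    rw [Real.sqrt_sq_eq_abs, Real.sqrt_mul hM0] at h2
    refine h2.trans_eq ?_
    congr 1
    rw [Real.sqrt_eq_rpow, ← Real.rpow_mul ht0.le]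
    congr 1; ring
  filter_upwards [ae_norm hN hreal] with x hx
  rw [hf x]; exact hx

lemma real_est_high {r v c Λ α β γ q μ C k a b : ℝ} (hr : 0 < r) (hc : 0 < c) (hΛ : 0 ≤ Λ)
    (hβ : β ≤ 1) (hq : 2 ≤ q) (hC : 0 ≤ C) (hv : c * r ^ (-γ) ≤ v)
    (hk : k ≤ Λ * (r ^ α * v ^ β)) (ha : |a| ≤ C * r ^ μ) :
    k * |a| ^ (q-1) * |b| ≤ (Λ * c ^ (β-1) * C ^ (q-2)) *
      r ^ (α - γ * (β - 1) + μ * (q-2)) * (r ^ (0:ℝ) + v * a^2 + v * b^2) := by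
  have hv0 : 0 < v := lt_of_lt_of_le (by positivity) hv
  have h1 : v ^ (β - 1) ≤ c ^ (β-1) * r ^ (-γ * (β-1)) := by
    calc v ^ (β - 1) ≤ (c * r ^ (-γ)) ^ (β-1) :=
          Real.rpow_le_rpow_of_nonpos (by positivity) hv (by linarith)
      _ = _ := by rw [Real.mul_rpow hc.le (by positivity), ← Real.rpow_mul hr.le]
  have h2 : |a| ^ (q-2) ≤ C ^ (q-2) * r ^ (μ * (q-2)) := by
    calc |a| ^ (q-2) ≤ (C * r ^ μ) ^ (q-2) :=
          Real.rpow_le_rpow (abs_nonneg _) ha (by linarith)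
      _ = _ := by rw [Real.mul_rpow hC (by positivity), ← Real.rpow_mul hr.le]
  have h3 : v * (|a| * |b|) ≤ r ^ (0:ℝ) + v * a^2 + v * b^2 := by
    have : |a| * |b| ≤ a^2 + b^2 := by
      rw [← sq_abs a, ← sq_abs b]
      nlinarith [sq_nonneg (|a| - |b|), sq_nonneg (|a|), sq_nonneg (|b|)]
    have h4 := mul_le_mul_of_nonneg_left this hv0.le
    rw [mul_add] at h4
    rw [Real.rpow_zero]
    linarith
  have e1 : |a| ^ (q-1) = |a| ^ (q-2) * |a| := by
    have := Real.rpow_add_of_nonneg (abs_nonneg a) (by linarith : 0 ≤ q - 2) zero_le_one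
    rw [Real.rpow_one] at this
    rw [← this]; congr 1; ring
  have e2 : v ^ β = v ^ (β-1) * v := by
    have := Real.rpow_add hv0 (β-1) 1
    rw [Real.rpow_one] at this
    rw [← this]; congr 1; ring
  have e3 : r ^ (α - γ * (β - 1) + μ * (q-2)) = r ^ α * r ^ (-γ * (β-1)) * r ^ (μ * (q-2)) := by
    rw [← Real.rpow_add hr, ← Real.rpow_add hr]; congr 1; ring
  calc k * |a| ^ (q-1) * |b| ≤ (Λ * (r ^ α * v ^ β)) * |a| ^ (q-1) * |b| := by gcongr
    _ = Λ * r ^ α * (v ^ (β-1) * |a| ^ (q-2) * (v * (|a| * |b|))) := by rw [e1, e2]; ring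
    _ ≤ Λ * r ^ α * ((c ^ (β-1) * r ^ (-γ * (β-1))) * (C ^ (q-2) * r ^ (μ * (q-2))) *
          (r ^ (0:ℝ) + v * a^2 + v * b^2)) := by gcongr
    _ = _ := by rw [e3]; ring

lemma real_est_low {r v c Λ α β γ q k e e' a b K : ℝ} (hr : 0 < r) (hc : 0 < c) (hΛ : 0 ≤ Λ)
    (hq1 : 1 < q) (hq2 : q < 2) (hqβ : 2 * β < q) (hv : c * r ^ (-γ) ≤ v)
    (hK : K ≤ Λ * (r ^ α * v ^ β)) (he : e = α - γ * β + γ * q / 2)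
    (he' : e' * ((2-q)/2) = e - k) :
    K * |a| ^ (q-1) * |b| ≤ (Λ * c ^ (β-q/2)) *
      r ^ k * (r ^ e' + v * a^2 + v * b^2) := by
  have hv0 : 0 < v := lt_of_lt_of_le (by positivity) hv
  have h1 : v ^ (β - q/2) ≤ c ^ (β-q/2) * r ^ (-γ * (β-q/2)) := by
    calc v ^ (β - q/2) ≤ (c * r ^ (-γ)) ^ (β-q/2) :=
          Real.rpow_le_rpow_of_nonpos (by positivity) hv (by linarith)
      _ = _ := by rw [Real.mul_rpow hc.le (by positivity), ← Real.rpow_mul hr.le]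
  have hP : 0 ≤ r ^ e' := by positivity
  have hX : 0 ≤ v * a^2 := by positivity
  have hY : 0 ≤ v * b^2 := by positivity
  have amgm : (r ^ e') ^ ((2-q)/2) * (v * a^2) ^ ((q-1)/2) * (v * b^2) ^ (1/2:ℝ) ≤
      r ^ e' + v * a^2 + v * b^2 := by
    refine (Real.geom_mean_le_arith_mean3_weighted (by linarith) (by linarith) (by norm_num)
      hP hX hY (by ring)).trans ?_
    nlinarith
  have ea : (v * a^2) ^ ((q-1)/2) = v ^ ((q-1)/2) * |a| ^ (q-1) := by
    rw [Real.mul_rpow hv0.le (sq_nonneg _), ← sq_abs, ← Real.rpow_natCast |a| 2,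
      ← Real.rpow_mul (abs_nonneg a)]
    congr 2; push_cast; ring
  have eb : (v * b^2) ^ (1/2:ℝ) = v ^ (1/2:ℝ) * |b| := by
    rw [Real.mul_rpow hv0.le (sq_nonneg _), ← sq_abs, ← Real.rpow_natCast |b| 2,
      ← Real.rpow_mul (abs_nonneg b)]
    norm_num
  have e2 : v ^ β = v ^ (β-q/2) * (v ^ ((q-1)/2) * v ^ (1/2:ℝ)) := by
    rw [← Real.rpow_add hv0, ← Real.rpow_add hv0]; congr 1; ring
  have e3 : r ^ α * r ^ (-γ * (β-q/2)) = r ^ k * (r ^ e') ^ ((2-q)/2) := by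
    rw [← Real.rpow_mul hr.le, he', ← Real.rpow_add hr, ← Real.rpow_add hr, he]
    congr 1; ring
  calc K * |a| ^ (q-1) * |b| ≤ (Λ * (r ^ α * v ^ β)) * |a| ^ (q-1) * |b| := by gcongr
    _ = Λ * r ^ α * (v ^ (β-q/2) * ((v * a^2) ^ ((q-1)/2) * (v * b^2) ^ (1/2:ℝ))) := by
        rw [ea, eb, e2]; ring
    _ ≤ Λ * r ^ α * ((c ^ (β-q/2) * r ^ (-γ * (β-q/2))) *
          ((v * a^2) ^ ((q-1)/2) * (v * b^2) ^ (1/2:ℝ))) := by gcongr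
    _ = (Λ * c ^ (β-q/2)) * (r ^ α * r ^ (-γ * (β-q/2))) *
          ((v * a^2) ^ ((q-1)/2) * (v * b^2) ^ (1/2:ℝ)) := by ring
    _ = (Λ * c ^ (β-q/2)) * r ^ k * ((r ^ e') ^ ((2-q)/2) *
          (v * a^2) ^ ((q-1)/2) * (v * b^2) ^ (1/2:ℝ)) := by rw [e3]; ring
    _ ≤ _ := by gcongr

lemma aset_ineq {N : ℕ} {α β γ q : ℝ} (hN : 5 ≤ N) (h : (α, q) ∈ Aset N β γ) :
    1 < q ∧ 2 * β < q ∧ 0 < α - γ * (β - 1) + (γ/2 + 2 - N)/2 * (q-2) ∧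
    0 < α - γ * β + N + q * (γ - N) / 2 := by
  have hN' : (5:ℝ) ≤ N := by exact_mod_cast hN
  unfold Aset qLow qHigh at h
  split_ifs at h with h1 h2 h3 h4
  · simp only [mem_ofPred_eq, max_lt_iff, lt_min_iff] at h
    obtain ⟨⟨a1, a2⟩, a3, a4⟩ := h
    rw [lt_div_iff₀ (by linarith)] at a3
    rw [lt_div_iff₀ (by linarith)] at a4
    refine ⟨a1, a2, by nlinarith, by nlinarith⟩
  · simp only [mem_ofPred_eq, max_lt_iff] at h
    obtain ⟨⟨a1, a2⟩, a3, a4⟩ := h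
    rw [lt_div_iff₀ (by linarith)] at a3
    refine ⟨a1, a2, by nlinarith, by rw [h2]; nlinarith⟩
  · simp only [mem_ofPred_eq, max_lt_iff] at h
    obtain ⟨⟨⟨a1, a2⟩, a3⟩, a4⟩ := h
    have h5 : (N:ℝ) < γ := lt_of_le_of_ne (not_lt.mp h1) (Ne.symm h2)
    rw [lt_div_iff₀ (by linarith)] at a4
    rw [div_lt_iff_of_neg (by linarith)] at a3
    refine ⟨a1, a2, by nlinarith, by nlinarith⟩
  · simp only [mem_ofPred_eq, max_lt_iff] at h
    obtain ⟨⟨⟨a1, a2⟩, a3⟩, a4⟩ := h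
    have h5 : (N:ℝ) < γ := lt_of_le_of_ne (not_lt.mp h1) (Ne.symm h2)
    rw [div_lt_iff_of_neg (by linarith)] at a3
    refine ⟨a1, a2, ?_, by nlinarith⟩
    have : (γ/2 + 2 - N)/2 = 0 := by rw [h4]; ring
    rw [this]; linarith
  · simp only [mem_ofPred_eq, max_lt_iff] at h
    obtain ⟨⟨⟨a1, a2⟩, a3⟩, a4⟩ := h
    have h5 : (N:ℝ) < γ := lt_of_le_of_ne (not_lt.mp h1) (Ne.symm h2)
    have h6 : 2 * (N:ℝ) - 4 < γ := lt_of_le_of_ne (not_lt.mp h3) (Ne.symm h4)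
    rw [div_lt_iff_of_neg (by linarith)] at a3 a4
    refine ⟨a1, a2, by nlinarith, by nlinarith⟩

lemma norm_one {N : ℕ} {V : ℝ → ℝ≥0∞} {u w : E N → ℝ} (h : H2norm V u w = 1) :
    (∫⁻ x, ENNReal.ofReal ((w x)^2)) ≤ 1 ∧
    (∫⁻ x : E N, V ‖x‖ * ENNReal.ofReal ((u x) ^ 2)) ≤ 1 := by
  unfold H2norm at h
  set A := ∫⁻ x, ENNReal.ofReal ((w x)^2)
  set B := ∫⁻ x : E N, V ‖x‖ * ENNReal.ofReal ((u x) ^ 2)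
  have h1 : (A + B).toReal = 1 := by
    have := congrArg (fun z : ℝ => z ^ (2:ℝ)) h
    simp only [Real.one_rpow] at this
    rw [← Real.rpow_mul ENNReal.toReal_nonneg] at this
    norm_num at this
    exact this
  have h2 : A + B = 1 := (ENNReal.toReal_eq_one_iff _).mp h1
  exact ⟨h2 ▸ le_self_add, h2 ▸ le_add_self⟩

lemma data_real {V : ℝ → ℝ≥0∞} {K : ℝ → ℝ} {R1 α β γ : ℝ}
    (hVfin : ∀ᵐ r ∂(volume.restrict (Set.Ioo (0:ℝ) R1)), V r < ⊤)
    (hess : essSup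
      (fun r : ℝ => ENNReal.ofReal (K r) / (ENNReal.ofReal r ^ α * V r ^ β))
      (volume.restrict (Set.Ioo (0:ℝ) R1)) < ⊤)
    (hinf : 0 < essInf (fun r : ℝ => ENNReal.ofReal r ^ γ * V r)
      (volume.restrict (Set.Ioo (0:ℝ) R1))) :
    ∃ c Λ : ℝ, 0 < c ∧ 0 ≤ Λ ∧ ∀ᵐ r : ℝ, 0 < r → (r < R1 → V r < ⊤ ∧
      c * r ^ (-γ) ≤ (V r).toReal ∧ K r ≤ Λ * (r ^ α * (V r).toReal ^ β)) := by
  obtain ⟨c, hc0, hc⟩ := ENNReal.lt_iff_exists_nnreal_btwn.mp hinf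
  have hc0' : (0:ℝ) < c := by exact_mod_cast hc0
  refine ⟨c, (essSup
      (fun r : ℝ => ENNReal.ofReal (K r) / (ENNReal.ofReal r ^ α * V r ^ β))
      (volume.restrict (Set.Ioo (0:ℝ) R1))).toReal, hc0', ENNReal.toReal_nonneg, ?_⟩
  set Λ := essSup
      (fun r : ℝ => ENNReal.ofReal (K r) / (ENNReal.ofReal r ^ α * V r ^ β))
      (volume.restrict (Set.Ioo (0:ℝ) R1)) with hΛ
  have h1 := ae_lt_of_lt_essInf hc
  have h2 := ENNReal.ae_le_essSup (μ := volume.restrict (Set.Ioo (0:ℝ) R1))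
    (fun r : ℝ => ENNReal.ofReal (K r) / (ENNReal.ofReal r ^ α * V r ^ β))
  rw [← hΛ] at h2
  rw [ae_restrict_iff' measurableSet_Ioo] at h1 h2 hVfin
  filter_upwards [h1, h2, hVfin] with r a1 a2 a3 hr hrR
  have hm : r ∈ Ioo 0 R1 := mem_Ioo.mpr ⟨hr, hrR⟩
  specialize a1 hm; specialize a2 hm; specialize a3 hm
  have hv : V r = ENNReal.ofReal (V r).toReal := (ENNReal.ofReal_toReal a3.ne).symm
  set v := (V r).toReal with hvdef
  have hvn : 0 ≤ v := ENNReal.toReal_nonneg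
  rw [hv, ENNReal.ofReal_rpow_of_pos hr, ← ENNReal.ofReal_mul (by positivity),
    ← ENNReal.ofReal_coe_nnreal, ENNReal.ofReal_lt_ofReal_iff_of_nonneg hc0'.le] at a1
  have hcv : c * r ^ (-γ) ≤ v := by
    rw [Real.rpow_neg hr.le, ← div_eq_mul_inv, div_le_iff₀ (by positivity)]
    linarith
  have hv0 : 0 < v := lt_of_lt_of_le (by positivity) hcv
  refine ⟨a3, hcv, ?_⟩
  rw [hv, ENNReal.ofReal_rpow_of_pos hr, ENNReal.ofReal_rpow_of_pos hv0,
    ← ENNReal.ofReal_mul (by positivity), ENNReal.div_le_iff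
      (by simpa using (by positivity : 0 < r ^ α * v ^ β)) ofReal_ne_top,
    ← ENNReal.ofReal_toReal hess.ne, ← ENNReal.ofReal_mul ENNReal.toReal_nonneg,
    ENNReal.ofReal_le_ofReal_iff (by positivity)] at a2
  exact a2

lemma final_tendsto {N : ℕ} (hN : 5 ≤ N) {V : ℝ → ℝ≥0∞} (hV : Measurable V) {K : ℝ → ℝ}
    {q M k e ρ : ℝ} (hM : 0 ≤ M) (hk : 0 < k) (he : -(N:ℝ) < e) (hρ : 0 < ρ) (hρ1 : ρ ≤ 1)
    (hVf : ∀ᵐ x : E N, ‖x‖ < ρ → V ‖x‖ < ⊤)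
    (hmain : ∀ u w h z : E N → ℝ, MemH2Vr V u w → MemH2Vr V h z → H2norm V u w = 1 →
      H2norm V h z = 1 → ∀ᵐ x : E N, ‖x‖ < ρ →
        K ‖x‖ * |u x| ^ (q-1) * |h x| ≤ M * ‖x‖ ^ k *
          (‖x‖ ^ e + (V ‖x‖).toReal * (u x)^2 + (V ‖x‖).toReal * (h x)^2)) :
    Tendsto (fun R => R0 N V K q R) (𝓝[>] (0:ℝ)) (𝓝 0) := by
  set I := ∫⁻ x in Metric.ball (0 : E N) 1, ENNReal.ofReal (‖x‖ ^ e) with hI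
  have hIfin : I < ⊤ := by
    have : IntegrableOn (fun x : E N => ‖x‖ ^ e) (Metric.ball 0 1) := by
      refine integrableOn_ball_of_norm_le_rpow (C := 1) (α := -e) (by simp; omega)
        (by simp; linarith) (Eventually.of_forall fun x => ?_) ?_
      · rw [neg_neg, one_mul, Real.norm_of_nonneg (by positivity)]
      · exact (measurable_norm.pow_const _).aestronglyMeasurable
    have h2 := this.2
    rwa [hasFiniteIntegral_iff_ofReal (Eventually.of_forall fun x => by positivity)] at h2
  have hbd : ∀ R, 0 < R → R < ρ → R0 N V K q R ≤ ENNReal.ofReal (M * R ^ k) * (I + 1 + 1) := by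
    intro R hR hRρ
    unfold R0
    refine iSup_le ?_
    rintro ⟨⟨⟨u, w⟩, ⟨h, z⟩⟩, hu, hh, hu1, hh1⟩
    simp only at hu hh hu1 hh1 ⊢
    have hAE := hmain u w h z hu hh hu1 hh1
    have hum : AEMeasurable (fun x : E N => V ‖x‖ * ENNReal.ofReal ((u x)^2)) :=
      (hV.comp measurable_norm).aemeasurable.mul
        ((hu.1.1.1.1.aemeasurable.pow_const 2).ennreal_ofReal)
    have hem : Measurable (fun x : E N => ENNReal.ofReal (‖x‖ ^ e)) :=
      (measurable_norm.pow_const _).ennreal_ofReal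
    calc ∫⁻ x in Metric.ball (0 : E N) R, ENNReal.ofReal (K ‖x‖ * |u x| ^ (q - 1) * |h x|)
        ≤ ∫⁻ x in Metric.ball (0 : E N) R, ENNReal.ofReal (M * R ^ k) *
          (ENNReal.ofReal (‖x‖ ^ e) + (V ‖x‖ * ENNReal.ofReal ((u x)^2) +
            V ‖x‖ * ENNReal.ofReal ((h x)^2))) := by
          refine lintegral_mono_ae ?_
          refine (ae_restrict_iff' measurableSet_ball).mpr ?_
          filter_upwards [hAE, hVf] with x hx hxV hxb
          have hxR : ‖x‖ < R := by simpa using hxb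
          specialize hx (hxR.trans hRρ)
          specialize hxV (hxR.trans hRρ)
          have hv : V ‖x‖ = ENNReal.ofReal (V ‖x‖).toReal := (ENNReal.ofReal_toReal hxV.ne).symm
          rw [hv]
          set v := (V ‖x‖).toReal
          have hvn : 0 ≤ v := ENNReal.toReal_nonneg
          rw [← ENNReal.ofReal_mul hvn, ← ENNReal.ofReal_mul hvn,
            ← ENNReal.ofReal_add (by positivity) (by positivity),
            ← ENNReal.ofReal_add (by positivity) (by positivity),
            ← ENNReal.ofReal_mul (by positivity)]
          apply ENNReal.ofReal_le_ofReal
          refine hx.trans ?_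
          rw [← add_assoc]
          gcongr
      _ = ENNReal.ofReal (M * R ^ k) * ∫⁻ x in Metric.ball (0 : E N) R,
          (ENNReal.ofReal (‖x‖ ^ e) + (V ‖x‖ * ENNReal.ofReal ((u x)^2) +
            V ‖x‖ * ENNReal.ofReal ((h x)^2))) := lintegral_const_mul' _ _ ofReal_ne_top
      _ ≤ ENNReal.ofReal (M * R ^ k) * (I + 1 + 1) := by
          gcongr
          rw [lintegral_add_left hem, lintegral_add_left' hum.restrict, add_assoc]
          gcongr
          · exact lintegral_mono_set (Metric.ball_subset_ball (by linarith))
          · exact (setLIntegral_le_lintegral _ _).trans (norm_one hu1).2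
          · exact (setLIntegral_le_lintegral _ _).trans (norm_one hh1).2
  have hlim : Tendsto (fun R : ℝ => ENNReal.ofReal (M * R ^ k) * (I + 1 + 1)) (𝓝[>] (0:ℝ)) (𝓝 0) := by
    have h1 : Tendsto (fun R : ℝ => M * R ^ k) (𝓝[>] (0:ℝ)) (𝓝 0) := by
      have : Tendsto (fun R : ℝ => M * R ^ k) (𝓝 (0:ℝ)) (𝓝 (M * 0 ^ k)) :=
        ((Real.continuous_rpow_const hk.le).tendsto 0).const_mul M
      rw [Real.zero_rpow hk.ne', mul_zero] at this
      exact this.mono_left nhdsWithin_le_nhds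
    have h2 := ENNReal.tendsto_ofReal h1
    have h3 := ENNReal.Tendsto.mul_const (b := I + 1 + 1) h2 (Or.inr (by finiteness))
    simpa using h3
  refine tendsto_of_tendsto_of_tendsto_of_le_of_le' tendsto_const_nhds hlim
    (Eventually.of_forall fun _ => zero_le) ?_
  filter_upwards [Ioo_mem_nhdsGT hρ] with R hR using hbd R hR.1 hR.2

/-- Theorem 2.5: if near the origin `K(r)/(r^{α₀}V(r)^{β₀})` is
essentially bounded and `ess inf_{r∈(0,R₁)} r^{γ₀}V(r) > 0` for some `γ₀ ≥ 4`, then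
`R₀(q₁,R) → 0` as `R → 0⁺` for all `q₁` with `(α₀,q₁) ∈ 𝒜_{β₀,γ₀}`. -/
theorem stmt7 (N : ℕ) (hN : 5 ≤ N) (V : ℝ → ℝ≥0∞) (K : ℝ → ℝ) (s : ℝ)
    (hV : HypV V) (hK : HypK K s) (R1 : ℝ) (hR1 : 0 < R1)
    (β₀ α₀ γ₀ : ℝ) (hβ₀ : 0 ≤ β₀) (hβ₀' : β₀ ≤ 1) (hγ₀ : 4 ≤ γ₀)
    (hVfin : ∀ᵐ r ∂(volume.restrict (Set.Ioo (0:ℝ) R1)), V r < ⊤)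
    (hess : essSup
      (fun r : ℝ => ENNReal.ofReal (K r) / (ENNReal.ofReal r ^ α₀ * V r ^ β₀))
      (volume.restrict (Set.Ioo (0:ℝ) R1)) < ⊤)
    (hinf : 0 < essInf (fun r : ℝ => ENNReal.ofReal r ^ γ₀ * V r)
      (volume.restrict (Set.Ioo (0:ℝ) R1))) :
    ∀ q1 : ℝ, (α₀, q1) ∈ Aset N β₀ γ₀ →
      Tendsto (fun R => R0 N V K q1 R) (𝓝[>] (0:ℝ)) (𝓝 0) := by
  intro q hq
  obtain ⟨hq1, hqβ, hE2, hE1⟩ := aset_ineq hN hq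
  obtain ⟨c, Λ, hc, hΛ, hdat⟩ := data_real hVfin hess hinf
  have hdat' := ae_norm hN hdat
  have hne : Nonempty (Fin N) := ⟨⟨0, by omega⟩⟩
  have : Nontrivial (E N) := by infer_instance
  have hx0 : ∀ᵐ x : E N, x ≠ 0 := by simp [ae_iff, measure_singleton]
  set ρ := min R1 1 with hρ
  have hρ0 : 0 < ρ := lt_min hR1 one_pos
  have hρR : ρ ≤ R1 := min_le_left _ _
  have hρ1 : ρ ≤ 1 := min_le_right _ _
  have hVf : ∀ᵐ x : E N, ‖x‖ < ρ → V ‖x‖ < ⊤ := by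
    filter_upwards [hdat'] with x hx hxr using (hx (hxr.trans_le hρR)).1
  rcases lt_or_ge q 2 with hq2 | hq2
  · set e := α₀ - γ₀ * β₀ + γ₀ * q / 2 with he
    set k := (e + N * (1 - q/2)) / 2 with hk
    have hk0 : 0 < k := by rw [hk, he]; linarith
    have h2q : 0 < 2 - q := by linarith
    have he' : (2 * (e - k) / (2 - q)) * ((2-q)/2) = e - k := by field_simp
    refine final_tendsto hN hV.1 (M := Λ * c ^ (β₀ - q/2)) (k := k)
      (e := 2 * (e - k) / (2 - q)) (by positivity) hk0 ?_ hρ0 hρ1 hVf ?_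
    · rw [lt_div_iff₀ h2q]
      linarith
    · intro u w h z _ _ _ _
      filter_upwards [hdat', hx0] with x hx hxne hxr
      obtain ⟨_, hv, hKx⟩ := hx (hxr.trans_le hρR)
      exact real_est_low (norm_pos_iff.mpr hxne) hc hΛ hq1 hq2 hqβ hv hKx he he'
  · obtain ⟨C, hC, hpt⟩ := pointwise_bound hN (γ := γ₀) (R2 := ρ) (c' := c⁻¹) hγ₀ hρ1
      (by positivity)
    refine final_tendsto hN hV.1 (M := Λ * c ^ (β₀ - 1) * C ^ (q-2))
      (k := α₀ - γ₀ * (β₀ - 1) + (γ₀/2 + 2 - N)/2 * (q-2)) (e := 0) (by positivity) hE2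
      (by simp; omega) hρ0 hρ1 hVf ?_
    intro u w h z hu _ hu1 _
    have hptu := hpt u w hu.1.1 hu.2 (norm_one hu1).1 ?_
    · filter_upwards [hdat', hx0, hptu] with x hx hxne hxu hxr
      obtain ⟨_, hv, hKx⟩ := hx (hxr.trans_le hρR)
      exact real_est_high (norm_pos_iff.mpr hxne) hc hΛ hβ₀' hq2 hC hv hKx (hxu hxr)
    · calc ∫⁻ x in Metric.ball (0 : E N) ρ, ENNReal.ofReal (‖x‖ ^ (-γ₀) * (u x)^2)
          ≤ ∫⁻ x in Metric.ball (0 : E N) ρ,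
            ENNReal.ofReal c⁻¹ * (V ‖x‖ * ENNReal.ofReal ((u x)^2)) := by
            refine lintegral_mono_ae ?_
            refine (ae_restrict_iff' measurableSet_ball).mpr ?_
            filter_upwards [hdat'] with x hx hxb
            have hxr : ‖x‖ < ρ := by simpa using hxb
            obtain ⟨hvt, hv, _⟩ := hx (hxr.trans_le hρR)
            rw [← ENNReal.ofReal_toReal hvt.ne, ← ENNReal.ofReal_mul ENNReal.toReal_nonneg,
              ← ENNReal.ofReal_mul (by positivity)]
            apply ENNReal.ofReal_le_ofReal
            rw [← mul_assoc]
            gcongr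
            rw [inv_mul_eq_div, le_div_iff₀ hc]
            linarith
        _ = ENNReal.ofReal c⁻¹ * ∫⁻ x in Metric.ball (0 : E N) ρ,
            V ‖x‖ * ENNReal.ofReal ((u x)^2) := lintegral_const_mul' _ _ ofReal_ne_top
        _ ≤ ENNReal.ofReal c⁻¹ * 1 := by
            gcongr
            exact (setLIntegral_le_lintegral _ _).trans (norm_one hu1).2
        _ = ENNReal.ofReal c⁻¹ := mul_one _

end
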